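/- arXiv:1511.01874 — 5 statements merged into one kernel-verified Lean document; each statement's English description precedes it below -/
import Mathlib

section
/- Let G be a finite hypergraph in which h ∉ B for every arc (h,B), let θ assign to each arc e ∈ G a real θ_e ∈ [0,1], and let T_1,…,T_n and R_1,…,R_n be sets of vertices of G with R_k ⊆ reach(G, T_k) for all k. Then Σ_{H ⊆ G : ∀k, reach(H,T_k)=R_k} ∏_{e∈H} θ_e · ∏_{e∈G\H} (1−θ_e) ≤ ∏_{e∈N}(1−θ_e) · ∏_{h : C_h ≠ ∅} [ Σ_{E1 ⊆ A_h, ∀k∈C_h : E1 ∩ D_k ≠ ∅} ∏_{e∈E1} θ_e · ∏_{e∈A_h\E1} (1−θ_e) ], where N = {(h,B) ∈ G : B ⊆ R_k and h ∉ R_k for some k}, C_h = {k : h ∈ R_k \ T_k}, A_h = {(h,B) ∈ G} \ N (arcs with head h not in N), and D_k = {(h,B) ∈ G : B ⊆ R_k}. -/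
open scoped Classical

/-- An arc is a pair of a head fact and a (finite) set of body facts. -/
abbrev Arc (α : Type*) := α × Finset α

variable {α : Type*}

/-- `reach G T` is the least set `R` of facts with `T ⊆ R` that is closed under
the arcs of `G`: for every arc `(h, B) ∈ G` with `B ⊆ R` we have `h ∈ R`. -/
def reach (G : Set (Arc α)) (T : Set α) : Set α :=
  ⋂₀ {R : Set α | T ⊆ R ∧ ∀ e ∈ G, (e.2 : Set α) ⊆ R → e.1 ∈ R}

/-- The vertices of a hypergraph: the facts appearing in its arcs. -/
def verts (G : Set (Arc α)) : Set α :=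
  {v | ∃ e ∈ G, v = e.1 ∨ v ∈ e.2}

/-- The induced subhypergraph `G[T]`. -/
def induced (G : Set (Arc α)) (T : Set α) : Set (Arc α) :=
  {e ∈ G | e.1 ∈ T ∧ (e.2 : Set α) ⊆ T}

/-- Facts reachable from `T` in at most `n` derivation steps. -/
def reachN (G : Set (Arc α)) (T : Set α) : ℕ → Set α
  | 0 => T
  | n + 1 => reachN G T n ∪ {h | ∃ B : Finset α, (h, B) ∈ G ∧ (B : Set α) ⊆ reachN G T n}

/-- The distance `d_T(h)` from `T` to `h` in `G`:
the least number of derivation steps needed to reach `h` from `T` (`∞` if unreachable). -/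
noncomputable def hdist (G : Set (Arc α)) (T : Set α) (h : α) : ℕ∞ :=
  sInf {d : ℕ∞ | ∃ m : ℕ, d = m ∧ h ∈ reachN G T m}

/-- A forward arc with respect to `T`: `d_T(h) > d_T(b)` for every body fact `b`. -/
def IsForward (G : Set (Arc α)) (T : Set α) (e : Arc α) : Prop :=
  ∀ b ∈ e.2, hdist G T b < hdist G T e.1

/-- The dependency graph of `G` has an edge `(u, v)` whenever `(u, B) ∈ G` and `v ∈ B`. -/
def DepEdge (G : Set (Arc α)) (u v : α) : Prop :=
  ∃ B, (u, B) ∈ G ∧ v ∈ B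

/-- A loop of `G`: a nonempty set of vertices inducing a strongly connected
subgraph of the dependency graph. -/
def IsLoop (G : Set (Arc α)) (L : Set α) : Prop :=
  L.Nonempty ∧ L ⊆ verts G ∧
    ∀ u ∈ L, ∀ v ∈ L,
      Relation.ReflTransGen (fun a b => DepEdge G a b ∧ a ∈ L ∧ b ∈ L) u v

/-- The justifications of a loop `L`: arcs with head in `L` and body disjoint from `L`. -/
def Just (G : Set (Arc α)) (L : Set α) : Set (Arc α) :=
  {e ∈ G | e.1 ∈ L ∧ ∀ b ∈ e.2, b ∉ L}

/-- In the random-subhypergraph model over a finite hypergraph `G` with arc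
probabilities `θ`, the probability of the subhypergraph `H ⊆ G`:
`P(H) = ∏_{e ∈ H} θ_e · ∏_{e ∈ G \ H} (1 - θ_e)`. -/
noncomputable def subProb (G : Finset (Arc α)) (θ : Arc α → ℝ) (H : Finset (Arc α)) : ℝ :=
  (∏ e ∈ H, θ e) * ∏ e ∈ G \ H, (1 - θ e)

/-- `N`: the arcs observed to be unselected,
`{(h,B) ∈ G : B ⊆ R_k and h ∉ R_k for some k}`. -/
noncomputable def Nfin (G : Finset (Arc α)) {n : ℕ} (R : Fin n → Set α) : Finset (Arc α) :=
  G.filter fun e => ∃ k, (e.2 : Set α) ⊆ R k ∧ e.1 ∉ R k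

/-- `A_h`: the arcs of `G` with head `h` that are not in `N`. -/
noncomputable def Afin (G : Finset (Arc α)) {n : ℕ} (R : Fin n → Set α) (h : α) :
    Finset (Arc α) :=
  (G.filter fun e => e.1 = h) \ Nfin G R

/-- `D_k = {(h,B) ∈ G : B ⊆ R_k}`. -/
noncomputable def Dfin (G : Finset (Arc α)) {n : ℕ} (R : Fin n → Set α) (k : Fin n) :
    Finset (Arc α) :=
  G.filter fun e => (e.2 : Set α) ⊆ R k

/-- `F_k = {(h,B) ∈ G : B ⊆ R_k and (h,B) is a forward arc w.r.t. T_k}`. -/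
noncomputable def Ffin (G : Finset (Arc α)) {n : ℕ} (T R : Fin n → Set α) (k : Fin n) :
    Finset (Arc α) :=
  G.filter fun e => (e.2 : Set α) ⊆ R k ∧ IsForward (G : Set (Arc α)) (T k) e

theorem subset_reach (G : Set (Arc α)) (T : Set α) : T ⊆ reach G T :=
  Set.subset_sInter fun _ => And.left

theorem head_mem_reach {G : Set (Arc α)} {T : Set α} {e : Arc α} (he : e ∈ G)
    (hB : (e.2 : Set α) ⊆ reach G T) : e.1 ∈ reach G T :=
  Set.mem_sInter.2 fun _ hR => hR.2 e he (hB.trans (Set.sInter_subset_of_mem hR))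

/-- A reachable fact outside the source set is the head of an arc with reachable body. -/
theorem exists_arc_of_mem_reach {G : Set (Arc α)} {T : Set α} {h : α}
    (hh : h ∈ reach G T) (hT : h ∉ T) :
    ∃ e ∈ G, e.1 = h ∧ (e.2 : Set α) ⊆ reach G T := by
  by_contra! hcon
  have hmem : reach G T \ {h} ∈
      {R : Set α | T ⊆ R ∧ ∀ e ∈ G, (e.2 : Set α) ⊆ R → e.1 ∈ R} := by
    refine ⟨fun t ht => ⟨subset_reach G T ht, ?_⟩, fun e he hB => ?_⟩
    · rintro rfl
      exact hT ht
    · have hB' := hB.trans Set.sdiff_subset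
      exact ⟨head_mem_reach he hB', fun heq => hcon e he heq hB'⟩
  exact (Set.mem_sInter.1 hh _ hmem).2 rfl

theorem finite_verts (G : Finset (Arc α)) : (verts (G : Set (Arc α))).Finite := by
  refine (G.biUnion fun e => insert e.1 e.2).finite_toSet.subset ?_
  rintro v ⟨e, he, hv⟩
  simp only [Finset.coe_biUnion, Set.mem_iUnion]
  exact ⟨e, he, by simpa using hv⟩

theorem subProb_nonneg {G : Finset (Arc α)} {θ : Arc α → ℝ}
    (hθ : ∀ e ∈ G, 0 ≤ θ e ∧ θ e ≤ 1) {H : Finset (Arc α)} (hH : H ⊆ G) :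
    0 ≤ subProb G θ H :=
  mul_nonneg (Finset.prod_nonneg fun e he => (hθ e (hH he)).1)
    (Finset.prod_nonneg fun e he => sub_nonneg.2 (hθ e (Finset.mem_sdiff.1 he).1).2)

theorem sum_powerset_subProb (G : Finset (Arc α)) (θ : Arc α → ℝ) :
    ∑ H ∈ G.powerset, subProb G θ H = 1 := by
  simp only [subProb]
  rw [← Finset.prod_add]
  simp

theorem subProb_union {S U : Finset (Arc α)} (hSU : Disjoint S U) (θ : Arc α → ℝ)
    {E F : Finset (Arc α)} (hE : E ⊆ S) (hF : F ⊆ U) :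
    subProb (S ∪ U) θ (E ∪ F) = subProb S θ E * subProb U θ F := by
  have hdiff : (S ∪ U) \ (E ∪ F) = (S \ E) ∪ (U \ F) := by
    ext e
    have := @hE e
    have := @hF e
    have : e ∈ S → e ∉ U := fun h => Finset.disjoint_left.1 hSU h
    simp only [Finset.mem_sdiff, Finset.mem_union]
    tauto
  simp only [subProb]
  rw [hdiff, Finset.prod_union (hSU.mono hE hF),
    Finset.prod_union (hSU.mono Finset.sdiff_subset Finset.sdiff_subset)]
  ring

/-- Events depending on disjoint sets of arcs are independent. -/
theorem sum_subProb_union {S U : Finset (Arc α)} (hSU : Disjoint S U) (θ : Arc α → ℝ)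
    (P Q : Finset (Arc α) → Prop) [DecidablePred P] [DecidablePred Q] :
    ∑ H ∈ (S ∪ U).powerset.filter (fun H => P (H ∩ S) ∧ Q (H ∩ U)), subProb (S ∪ U) θ H =
      (∑ E ∈ S.powerset.filter P, subProb S θ E) *
        ∑ F ∈ U.powerset.filter Q, subProb U θ F := by
  rw [Finset.sum_mul_sum, ← Finset.sum_product']
  have hsplit : ∀ H ⊆ S ∪ U, H ∩ S ∪ H ∩ U = H := fun H hH => by
    rw [← Finset.inter_union_distrib_left, Finset.inter_eq_left.2 hH]
  have hleft : ∀ E ⊆ S, ∀ F ⊆ U, (E ∪ F) ∩ S = E := fun E hE F hF => by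
    rw [Finset.union_inter_distrib_right, Finset.inter_eq_left.2 hE,
      Finset.disjoint_iff_inter_eq_empty.1 (hSU.symm.mono_left hF), Finset.union_empty]
  have hright : ∀ E ⊆ S, ∀ F ⊆ U, (E ∪ F) ∩ U = F := fun E hE F hF => by
    rw [Finset.union_inter_distrib_right, Finset.inter_eq_left.2 hF,
      Finset.disjoint_iff_inter_eq_empty.1 (hSU.mono_left hE), Finset.empty_union]
  refine Finset.sum_nbij' (fun H => (H ∩ S, H ∩ U)) (fun p => p.1 ∪ p.2) ?_ ?_ ?_ ?_ ?_
  · intro H hH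
    simp only [Finset.mem_filter] at hH
    simpa [Finset.inter_subset_right] using hH.2
  · rintro ⟨E, F⟩ hp
    simp only [Finset.mem_product, Finset.mem_filter, Finset.mem_powerset] at hp
    obtain ⟨⟨hE, hP⟩, hF, hQ⟩ := hp
    simp only [Finset.mem_filter, Finset.mem_powerset]
    rw [hleft E hE F hF, hright E hE F hF]
    exact ⟨Finset.union_subset_union hE hF, hP, hQ⟩
  · intro H hH
    exact hsplit H (Finset.mem_powerset.1 (Finset.mem_filter.1 hH).1)
  · rintro ⟨E, F⟩ hp
    simp only [Finset.mem_product, Finset.mem_filter, Finset.mem_powerset] at hp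
    simp only [hleft E hp.1.1 F hp.2.1, hright E hp.1.1 F hp.2.1]
  · intro H hH
    rw [← subProb_union hSU θ Finset.inter_subset_right Finset.inter_subset_right,
      hsplit H (Finset.mem_powerset.1 (Finset.mem_filter.1 hH).1)]

/-- Events depending on pairwise disjoint sets of arcs are mutually independent. -/
theorem sum_subProb_forall {ι : Type*} (s : Finset ι) (A : ι → Finset (Arc α))
    (hA : (s : Set ι).PairwiseDisjoint A) (θ : Arc α → ℝ) (P : ι → Finset (Arc α) → Prop)
    [∀ i, DecidablePred (P i)]
    (S : Finset (Arc α)) (hS : ∀ i ∈ s, A i ⊆ S) :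
    ∑ H ∈ S.powerset.filter (fun H => ∀ i ∈ s, P i (H ∩ A i)), subProb S θ H =
      ∏ i ∈ s, ∑ E ∈ (A i).powerset.filter (P i), subProb (A i) θ E := by
  induction s using Finset.induction_on generalizing S with
  | empty => simpa using sum_powerset_subProb S θ
  | insert i s hi ih =>
    have hsub : ∀ j ∈ s, A j ⊆ S \ A i := fun j hj =>
      Finset.subset_sdiff.2 ⟨hS j (Finset.mem_insert_of_mem hj),
        hA (by simp [hj]) (by simp) fun h => hi (h ▸ hj)⟩
    rw [Finset.prod_insert hi,
      ← ih (hA.subset (Finset.coe_subset.2 (Finset.subset_insert i s))) (S \ A i) hsub,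
      ← sum_subProb_union Finset.disjoint_sdiff,
      Finset.union_sdiff_of_subset (hS i (Finset.mem_insert_self i s))]
    refine Finset.sum_congr (Finset.filter_congr fun H _ => ?_) fun _ _ => rfl
    rw [Finset.forall_mem_insert]
    refine and_congr_right fun _ => forall₂_congr fun j hj => ?_
    rw [Finset.inter_assoc, Finset.inter_eq_right.2 (hsub j hj)]

theorem pairwiseDisjoint_Afin (G : Finset (Arc α)) {n : ℕ} (R : Fin n → Set α) (s : Set α) :
    s.PairwiseDisjoint (Afin G R) := by
  intro h _ h' _ hne
  refine Finset.disjoint_left.2 fun e he he' => hne ?_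
  simp only [Afin, Finset.mem_sdiff, Finset.mem_filter] at he he'
  exact he.1.2.symm.trans he'.1.2

/-- Upper bound on the likelihood
`Pr(⋂_k (reach(H, T_k) = R_k))` (Theorem `learning`, upper bound). -/
theorem likelihood_upper_bound {α : Type*} (G : Finset (Arc α)) (θ : Arc α → ℝ)
    (hθ : ∀ e ∈ G, 0 ≤ θ e ∧ θ e ≤ 1)
    (hhead : ∀ e ∈ G, e.1 ∉ e.2)
    (n : ℕ) (T R : Fin n → Set α)
    (hTv : ∀ k, T k ⊆ verts (G : Set (Arc α)))
    (hRv : ∀ k, R k ⊆ verts (G : Set (Arc α)))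
    (hR : ∀ k, R k ⊆ reach (G : Set (Arc α)) (T k)) :
    (∑ H ∈ G.powerset.filter
          (fun (H : Finset (Arc α)) => ∀ k, reach (↑H : Set (Arc α)) (T k) = R k),
        subProb G θ H)
    ≤ (∏ e ∈ Nfin G R, (1 - θ e)) *
        (∏ᶠ h ∈ {h : α | ∃ k, h ∈ R k \ T k},
          ∑ E1 ∈ (Afin G R h).powerset.filter
              (fun E1 => ∀ k, h ∈ R k \ T k → (E1 ∩ Dfin G R k).Nonempty),
            (∏ e ∈ E1, θ e) * ∏ e ∈ Afin G R h \ E1, (1 - θ e)) := by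
  have hfin : {h : α | ∃ k, h ∈ R k \ T k}.Finite :=
    (finite_verts G).subset fun h ⟨k, hk⟩ => hRv k hk.1
  have hNG : Nfin G R ⊆ G := Finset.filter_subset _ _
  have hAG : ∀ h ∈ hfin.toFinset, Afin G R h ⊆ G \ Nfin G R := fun h _ =>
    Finset.sdiff_subset_sdiff (Finset.filter_subset _ _) subset_rfl
  rw [finprod_mem_eq_finite_toFinset_prod _ hfin]
  have hprod := sum_subProb_forall hfin.toFinset (Afin G R) (pairwiseDisjoint_Afin G R _) θ
    (fun h E => ∀ k, h ∈ R k \ T k → (E ∩ Dfin G R k).Nonempty) (G \ Nfin G R) hAG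
  have hempty : ∑ E ∈ (Nfin G R).powerset.filter (· = ∅), subProb (Nfin G R) θ E =
      ∏ e ∈ Nfin G R, (1 - θ e) := by
    rw [Finset.filter_eq', if_pos (Finset.empty_mem_powerset _)]
    simp [subProb]
  have hindep := sum_subProb_union (S := Nfin G R) (U := G \ Nfin G R)
    Finset.disjoint_sdiff θ (· = ∅)
    (fun H => ∀ h ∈ hfin.toFinset, ∀ k, h ∈ R k \ T k →
      ((H ∩ Afin G R h) ∩ Dfin G R k).Nonempty)
  rw [hempty, hprod, Finset.union_sdiff_of_subset hNG] at hindep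
  refine le_of_le_of_eq ?_ hindep
  refine Finset.sum_le_sum_of_subset_of_nonneg (fun H hH => ?_) fun H hH _ =>
    subProb_nonneg hθ (Finset.mem_powerset.1 (Finset.mem_filter.1 hH).1)
  obtain ⟨hHG, hreach⟩ := Finset.mem_filter.1 hH
  have hHN : ∀ e ∈ H, e ∉ Nfin G R := fun e he heN => by
    obtain ⟨_, k, hB, hh⟩ := Finset.mem_filter.1 heN
    rw [← hreach k] at hB hh
    exact hh (head_mem_reach (Finset.mem_coe.2 he) hB)
  refine Finset.mem_filter.2 ⟨hHG, ?_, fun h _ k hk => ?_⟩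
  · exact Finset.disjoint_iff_inter_eq_empty.1 (Finset.disjoint_left.2 hHN)
  · obtain ⟨e, he, heh, hB⟩ := exists_arc_of_mem_reach ((hreach k).symm ▸ hk.1) hk.2
    rw [hreach k] at hB
    have heH : e ∈ H := he
    have heG : e ∈ G := Finset.mem_powerset.1 hHG heH
    refine ⟨e, ?_⟩
    simp only [Finset.mem_inter, Finset.mem_sdiff, Afin, Dfin, Finset.mem_filter]
    exact ⟨⟨⟨heH, heG, hHN e heH⟩, ⟨heG, heh⟩, hHN e heH⟩, heG, hB⟩
end

section
/- Let G be a finite hypergraph, let θ assign to each arc e ∈ G a real θ_e ∈ [0,1], and let T_1,…,T_n and R_1,…,R_n be sets of vertices of G with T_k ⊆ R_k for all k. Then Σ_{H ⊆ G : ∀k, reach(H,T_k)=R_k} ∏_{e∈H} θ_e · ∏_{e∈G\H} (1−θ_e) = ∏_{e∈N}(1−θ_e) · Pr(H' satisfies: for every loop L of G and every k with L ⊆ R_k \ T_k, there exists an arc e = (h,B) ∈ J_G(L) \ N with B ⊆ R_k and e ∈ H'), where N = {(h,B) ∈ G : B ⊆ R_k and h ∉ R_k for some k}. -/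
open scoped Classical

variable {α : Type*}

section Reach

theorem reach_subset {G : Set (Arc α)} {T R : Set α} (hT : T ⊆ R)
    (hR : ∀ e ∈ G, (e.2 : Set α) ⊆ R → e.1 ∈ R) : reach G T ⊆ R :=
  Set.sInter_subset_of_mem ⟨hT, hR⟩

/-- Every nonempty finite set of vertices contains a terminal strongly connected component of
the dependency graph it induces. -/
theorem exists_terminal_loop {G : Set (Arc α)} {U : Set α} (hU : U.Nonempty) (hfin : U.Finite)
    (hUv : U ⊆ verts G) :
    ∃ L ⊆ U, IsLoop G L ∧ ∀ a ∈ L, ∀ b ∈ U, DepEdge G a b → b ∈ L := by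
  let r : α → α → Prop := fun a b => DepEdge G a b ∧ a ∈ U ∧ b ∈ U
  let D : α → Set α := fun x => {y | Relation.ReflTransGen r x y}
  have D_sub : ∀ x ∈ U, D x ⊆ U := by
    intro x hx y hy
    rcases Relation.ReflTransGen.cases_tail hy with h | ⟨z, -, hz⟩
    · exact h ▸ hx
    · exact hz.2.2
  obtain ⟨x, hx, hmin⟩ := Set.exists_min_image U (fun x => (D x).ncard) hfin hU
  have D_eq : ∀ y ∈ D x, D y = D x := fun y hy =>
    Set.eq_of_subset_of_ncard_le (fun _ hz => Relation.ReflTransGen.trans hy hz)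
      (hmin y (D_sub x hx hy)) (hfin.subset (D_sub x hx))
  refine ⟨D x, D_sub x hx, ⟨⟨x, .refl⟩, (D_sub x hx).trans hUv, ?_⟩, ?_⟩
  · intro u hu v hv
    have huv : Relation.ReflTransGen r u v := by
      rw [← D_eq u hu] at hv
      exact hv
    clear hv
    induction huv with
    | refl => exact .refl
    | tail hub hbc ih =>
      have hb := Relation.ReflTransGen.trans hu hub
      exact ih.tail ⟨hbc.1, hb, hb.tail hbc⟩
  · intro a ha b hb hab
    exact Relation.ReflTransGen.tail ha ⟨hab, D_sub x hx ha, hb⟩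

/-- If `H` has no arc leaving `R`, then `T` reaches all of `R` through `H` exactly when
every loop inside `R \ T` is justified by an arc of `H`. -/
theorem reach_eq_iff {G : Finset (Arc α)} {H : Set (Arc α)} (hHG : H ⊆ G) {T R : Set α}
    (hRv : R ⊆ verts (G : Set (Arc α))) (hTR : T ⊆ R) :
    reach H T = R ↔ (∀ e ∈ H, (e.2 : Set α) ⊆ R → e.1 ∈ R) ∧
      ∀ L : Set α, IsLoop (G : Set (Arc α)) L → L ⊆ R \ T →
        ∃ e ∈ Just (G : Set (Arc α)) L, (e.2 : Set α) ⊆ R ∧ e ∈ H := by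
  constructor
  · intro h
    have hcl : ∀ e ∈ H, (e.2 : Set α) ⊆ R → e.1 ∈ R := by
      intro e he hB
      rw [← h] at hB ⊢
      exact head_mem_reach he hB
    refine ⟨hcl, fun L hL hLR => ?_⟩
    by_contra! hno
    have hsub : reach H T ⊆ R \ L := by
      refine reach_subset (fun t ht => ⟨hTR ht, fun htL => (hLR htL).2 ht⟩) fun e he hB => ?_
      have hBR : (e.2 : Set α) ⊆ R := fun b hb => (hB hb).1
      exact ⟨hcl e he hBR, fun heL => hno e ⟨hHG he, heL, fun b hb => (hB hb).2⟩ hBR he⟩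
    obtain ⟨x, hx⟩ := hL.1
    exact (hsub (h ▸ (hLR hx).1)).2 hx
  · rintro ⟨hcl, hloop⟩
    refine (reach_subset hTR hcl).antisymm ?_
    rw [← Set.sdiff_eq_empty]
    by_contra hne
    obtain ⟨L, hLU, hL, hterm⟩ := exists_terminal_loop (Set.nonempty_iff_ne_empty.2 hne)
      ((finite_verts G).subset (Set.sdiff_subset.trans hRv)) (Set.sdiff_subset.trans hRv)
    obtain ⟨e, ⟨heG, heL, hdisj⟩, hBR, heH⟩ := hloop L hL fun x hx =>
      ⟨(hLU hx).1, fun hxT => (hLU hx).2 (subset_reach H T hxT)⟩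
    refine (hLU heL).2 (head_mem_reach heH fun b hb => ?_)
    by_contra hbr
    exact hdisj b hb (hterm e.1 heL b ⟨hBR hb, hbr⟩ ⟨e.2, heG, hb⟩)

end Reach

section Prob

theorem subProb_union_s9 {M N K J : Finset (Arc α)} (hMN : Disjoint M N) (hK : K ⊆ M) (hJ : J ⊆ N)
    (θ : Arc α → ℝ) : subProb (M ∪ N) θ (K ∪ J) = subProb M θ K * subProb N θ J := by
  have hdiff : (M ∪ N) \ (K ∪ J) = M \ K ∪ N \ J := by
    ext e
    have := @hK e
    have := @hJ e
    have : e ∈ M → e ∉ N := fun h => Finset.disjoint_left.1 hMN h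
    simp only [Finset.mem_sdiff, Finset.mem_union]
    tauto
  unfold subProb
  rw [hdiff, Finset.prod_union (hMN.mono hK hJ),
    Finset.prod_union (hMN.mono Finset.sdiff_subset Finset.sdiff_subset)]
  ring

theorem sum_subProb (N : Finset (Arc α)) (θ : Arc α → ℝ) :
    ∑ J ∈ N.powerset, subProb N θ J = 1 := by
  simp [subProb, ← Finset.prod_add]

theorem subProb_empty (N : Finset (Arc α)) (θ : Arc α → ℝ) :
    subProb N θ ∅ = ∏ e ∈ N, (1 - θ e) := by
  simp [subProb]

/-- Events not depending on the arcs of `N` are independent of the event that no arc of `N`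
is selected. -/
theorem sum_subProb_disjoint_and {G N : Finset (Arc α)} (hN : N ⊆ G) (θ : Arc α → ℝ)
    (p : Finset (Arc α) → Prop) (hp : ∀ H, p (H \ N) ↔ p H) :
    ∑ H ∈ G.powerset.filter (fun H => Disjoint H N ∧ p H), subProb G θ H =
      (∏ e ∈ N, (1 - θ e)) * ∑ H ∈ G.powerset.filter p, subProb G θ H := by
  obtain ⟨M, hMN, rfl⟩ : ∃ M, Disjoint M N ∧ G = M ∪ N :=
    ⟨G \ N, Finset.sdiff_disjoint, (Finset.sdiff_union_of_subset hN).symm⟩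
  have hsdiff : ∀ K ⊆ M, ∀ J ⊆ N, (K ∪ J) \ N = K := by
    intro K hK J hJ
    rw [Finset.union_sdiff_distrib, Finset.sdiff_eq_empty_iff_subset.2 hJ, Finset.union_empty,
      Finset.sdiff_eq_self_of_disjoint (hMN.mono_left hK)]
  have hleft : ∑ H ∈ (M ∪ N).powerset.filter (fun H => Disjoint H N ∧ p H),
      subProb (M ∪ N) θ H =
        ∑ K ∈ M.powerset.filter p, subProb M θ K * ∏ e ∈ N, (1 - θ e) := by
    refine Finset.sum_congr ?_ ?_
    · ext H
      simp only [Finset.mem_filter, Finset.mem_powerset]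
      constructor
      · rintro ⟨h, hd, hpH⟩
        exact ⟨hd.left_le_of_le_sup_right h, hpH⟩
      · rintro ⟨h, hpH⟩
        exact ⟨h.trans Finset.subset_union_left, hMN.mono_left h, hpH⟩
    · intro K hK
      simp only [Finset.mem_filter, Finset.mem_powerset] at hK
      rw [← subProb_empty, ← subProb_union_s9 hMN hK.1 (Finset.empty_subset N), Finset.union_empty]
  have hright : ∑ H ∈ (M ∪ N).powerset.filter p, subProb (M ∪ N) θ H =
      ∑ x ∈ M.powerset.filter p ×ˢ N.powerset, subProb M θ x.1 * subProb N θ x.2 := by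
    symm
    refine Finset.sum_nbij' (fun x => x.1 ∪ x.2) (fun H => (H \ N, H ∩ N)) ?_ ?_ ?_ ?_ ?_
    · rintro ⟨K, J⟩ h
      simp only [Finset.mem_product, Finset.mem_filter, Finset.mem_powerset] at h ⊢
      exact ⟨Finset.union_subset_union h.1.1 h.2,
        (hp _).1 ((hsdiff K h.1.1 J h.2).symm ▸ h.1.2)⟩
    · intro H h
      simp only [Finset.mem_product, Finset.mem_filter, Finset.mem_powerset] at h ⊢
      refine ⟨⟨sdiff_le_iff.2 ?_, (hp H).2 h.2⟩, Finset.inter_subset_right⟩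
      rw [sup_comm]
      exact h.1
    · rintro ⟨K, J⟩ h
      simp only [Finset.mem_product, Finset.mem_filter, Finset.mem_powerset] at h
      refine Prod.ext (hsdiff K h.1.1 J h.2) ?_
      change (K ∪ J) ∩ N = J
      rw [Finset.union_inter_distrib_right,
        Finset.disjoint_iff_inter_eq_empty.1 (hMN.mono_left h.1.1), Finset.empty_union,
        Finset.inter_eq_left.2 h.2]
    · intro H _
      exact Finset.sdiff_union_inter H N
    · rintro ⟨K, J⟩ h
      simp only [Finset.mem_product, Finset.mem_filter, Finset.mem_powerset] at h
      exact (subProb_union_s9 hMN h.1.1 h.2 θ).symm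
  rw [hleft, hright, Finset.sum_product, ← Finset.sum_mul_sum, sum_subProb, ← Finset.sum_mul, mul_one, mul_comm]

end Prob

/-- Exact expression for the likelihood (Lemma `likelihood`): the probability that
`reach(H, T_k) = R_k` for all `k` equals `∏_{e ∈ N} (1 - θ_e)` times the probability
that the random subhypergraph justifies, outside of `N`, every loop contained in
some `R_k \ T_k`. -/
theorem likelihood_exact {α : Type*} (G : Finset (Arc α)) (θ : Arc α → ℝ)
    (hθ : ∀ e ∈ G, 0 ≤ θ e ∧ θ e ≤ 1)
    (n : ℕ) (T R : Fin n → Set α)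
    (hTv : ∀ k, T k ⊆ verts (G : Set (Arc α)))
    (hRv : ∀ k, R k ⊆ verts (G : Set (Arc α)))
    (hTR : ∀ k, T k ⊆ R k) :
    (∑ H ∈ G.powerset.filter
          (fun (H : Finset (Arc α)) => ∀ k, reach (↑H : Set (Arc α)) (T k) = R k),
        subProb G θ H)
    = (∏ e ∈ Nfin G R, (1 - θ e)) *
        ∑ H ∈ G.powerset.filter
            (fun (H : Finset (Arc α)) =>
              ∀ L : Set α, IsLoop (G : Set (Arc α)) L → ∀ k, L ⊆ R k \ T k →
                ∃ e ∈ Just (G : Set (Arc α)) L,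
                  e ∉ Nfin G R ∧ (e.2 : Set α) ⊆ R k ∧ e ∈ H),
          subProb G θ H := by
  rw [← sum_subProb_disjoint_and (N := Nfin G R) (Finset.filter_subset _ G) θ]
  · refine Finset.sum_congr (Finset.filter_congr fun H hH => ?_) fun _ _ => rfl
    have hHG := Finset.mem_powerset.1 hH
    rw [forall_congr' fun k => reach_eq_iff (Finset.coe_subset.2 hHG) (hRv k) (hTR k),
      forall_and]
    have hdisj : (∀ k, ∀ e ∈ (H : Set (Arc α)), (e.2 : Set α) ⊆ R k → e.1 ∈ R k) ↔
        Disjoint H (Nfin G R) := by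
      rw [Finset.disjoint_left]
      constructor
      · intro h e he heN
        obtain ⟨k, hB, hh⟩ := (Finset.mem_filter.1 heN).2
        exact hh (h k e he hB)
      · intro h k e he hB
        by_contra hh
        exact h he (Finset.mem_filter.2 ⟨hHG he, k, hB, hh⟩)
    rw [hdisj]
    refine and_congr_right fun hd => ?_
    constructor
    · intro h L hL k hLR
      obtain ⟨e, heJ, hB, he⟩ := h k L hL hLR
      exact ⟨e, heJ, Finset.disjoint_left.1 hd he, hB, he⟩
    · intro h k L hL hLR
      obtain ⟨e, heJ, -, hB, he⟩ := h L hL k hLR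
      exact ⟨e, heJ, hB, he⟩
  · intro H
    simp only [Finset.mem_sdiff]
    refine forall₄_congr fun L _ k _ => exists_congr fun e => ?_
    tauto
end

section
/- Let G⊥ be a hypergraph on a set of facts, let T be a set of facts, and let G⊥_T be the extended hypergraph of G⊥ with respect to T. Then for every H ⊆ G⊥, reach(G⊥_T, SH) = SH ∪ reach(H, T), where SH = {s_e : e ∈ H}. -/
open scoped Classical

variable {α : Type*}

/-- The fresh vertex `s_e` associated with an arc `e` is modelled as `Sum.inr e`;
original facts are embedded via `Sum.inl`. The extended arc of `e = (h, B)` is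
`(h, B ∪ {s_e})`. -/
noncomputable def extArc (e : Arc α) : Arc (α ⊕ Arc α) :=
  (Sum.inl e.1, e.2.image Sum.inl ∪ {Sum.inr e})

/-- The extended hypergraph `G⊥_T`: each arc `e = (h, B)` of `G⊥` becomes
`(h, B ∪ {s_e})`, and additionally there is an arc `(t, ∅)` for each `t ∈ T`. -/
noncomputable def extHyp (G : Set (Arc α)) (T : Set α) : Set (Arc (α ⊕ Arc α)) :=
  (extArc '' G) ∪ {e' | ∃ t ∈ T, e' = (Sum.inl t, (∅ : Finset (α ⊕ Arc α)))}

/-- Reachability in the extended hypergraph: for every `H ⊆ G⊥`,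
`reach(G⊥_T, SH) = SH ∪ reach(H, T)`, where `SH = {s_e : e ∈ H}`. -/
theorem extHyp_reach {α : Type*} (G : Set (Arc α)) (T : Set α)
    (H : Set (Arc α)) (hH : H ⊆ G) :
    reach (extHyp G T) (Sum.inr '' H) =
      (Sum.inr '' H) ∪ (Sum.inl '' reach H T) := by
  apply Set.Subset.antisymm
  · refine reach_subset Set.subset_union_left ?_
    rintro _ (⟨e, -, rfl⟩ | ⟨t, ht, rfl⟩) hB
    · have heH : e ∈ H := by
        simpa using hB (show Sum.inr e ∈ _ by simp [extArc])
      refine Or.inr ⟨e.1, head_mem_reach heH fun b hb => ?_, rfl⟩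
      have hb' : Sum.inl b ∈ ((extArc e).2 : Set (α ⊕ Arc α)) := by
        simpa [extArc] using hb
      simpa using hB hb'
    · exact Or.inr ⟨t, subset_reach H T ht, rfl⟩
  · refine Set.union_subset (subset_reach _ _) (Set.image_subset_iff.2 (reach_subset ?_ ?_))
    · intro t ht
      exact head_mem_reach (e := (Sum.inl t, ∅)) (Or.inr ⟨t, ht, rfl⟩) (by simp)
    · intro e he hB
      refine head_mem_reach (e := extArc e) (Or.inl ⟨e, hH he, rfl⟩) fun v hv => ?_
      simp only [extArc, Finset.coe_union, Finset.coe_image, Finset.coe_singleton] at hv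
      rcases hv with ⟨b, hb, rfl⟩ | rfl
      · exact hB hb
      · exact subset_reach _ _ ⟨e, he, rfl⟩
end

section
/- Let G be a hypergraph and T a set of facts, and let G_→ = {e ∈ G : e is a forward arc with respect to T}. Then reach(G_→, T) = reach(G, T), and moreover the distances with respect to T are preserved: for every fact h, the distance from T to h in G_→ equals the distance from T to h in G. -/
open scoped Classical

variable {α : Type*}

theorem reachN_mono (G : Set (Arc α)) (T : Set α) : Monotone (reachN G T) :=
  monotone_nat_of_le_succ fun _ => Set.subset_union_left

theorem hdist_le_iff (G : Set (Arc α)) (T : Set α) (h : α) (n : ℕ) :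
    hdist G T h ≤ n ↔ h ∈ reachN G T n := by
  constructor
  · intro hle
    obtain ⟨d, ⟨m, rfl, hm⟩, hlt⟩ :=
      sInf_lt_iff.mp (lt_of_le_of_lt hle (Nat.cast_lt.mpr n.lt_succ_self))
    exact reachN_mono G T (Nat.lt_succ_iff.mp (Nat.cast_lt.mp hlt)) hm
  · exact fun hmem => sInf_le ⟨n, rfl, hmem⟩

theorem reachN_subset_of_closed {G : Set (Arc α)} {T R : Set α} (hT : T ⊆ R)
    (hR : ∀ e ∈ G, (e.2 : Set α) ⊆ R → e.1 ∈ R) (n : ℕ) : reachN G T n ⊆ R := by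
  induction n with
  | zero => exact hT
  | succ n ih =>
    rintro h (hh | ⟨B, hB, hsub⟩)
    · exact ih hh
    · exact hR (h, B) hB (hsub.trans ih)

theorem reach_eq_iUnion_reachN (G : Set (Arc α)) (T : Set α) :
    reach G T = ⋃ n, reachN G T n := by
  apply Set.Subset.antisymm
  · refine Set.sInter_subset_of_mem ⟨Set.subset_iUnion (reachN G T) 0, fun e he hsub => ?_⟩
    obtain ⟨n, hn⟩ := (reachN_mono G T).directed_le.exists_mem_subset_of_finset_subset_biUnion hsub
    exact Set.mem_iUnion.mpr ⟨n + 1, Or.inr ⟨e.2, he, hn⟩⟩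
  · exact Set.iUnion_subset fun n => Set.subset_sInter fun R hR =>
      reachN_subset_of_closed hR.1 hR.2 n

theorem reachN_forward (G : Set (Arc α)) (T : Set α) (n : ℕ) :
    reachN {e ∈ G | IsForward G T e} T n = reachN G T n := by
  induction n with
  | zero => rfl
  | succ n ih =>
    ext h
    simp only [reachN, ih, Set.mem_union, Set.mem_ofPred_eq]
    constructor
    · rintro (hh | ⟨B, hB, hsub⟩)
      · exact Or.inl hh
      · exact Or.inr ⟨B, hB.1, hsub⟩
    · rintro (hh | ⟨B, hB, hsub⟩)
      · exact Or.inl hh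
      · by_cases hh : h ∈ reachN G T n
        · exact Or.inl hh
        · refine Or.inr ⟨B, ⟨hB, fun b hb => ?_⟩, hsub⟩
          exact lt_of_le_of_lt ((hdist_le_iff G T b n).mpr (hsub hb))
            (not_le.mp (mt (hdist_le_iff G T h n).mp hh))

/-- Restricting a hypergraph to its forward arcs with respect to `T` preserves both
reachability from `T` and all distances from `T`. -/
theorem forward_arcs_preserve {α : Type*} (G : Set (Arc α)) (T : Set α) :
    reach {e ∈ G | IsForward G T e} T = reach G T ∧
      ∀ h : α, hdist {e ∈ G | IsForward G T e} T h = hdist G T h := by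
  constructor
  · simp only [reach_eq_iUnion_reachN, reachN_forward]
  · intro h
    simp only [hdist, reachN_forward]
end

section
/- Let G be a hypergraph in which h ∉ B for every arc (h,B), and let T_1,…,T_n and R_1,…,R_n be sets of vertices of G with R_k ⊆ reach(G, T_k) for all k. Define N = {(h,B) ∈ G : B ⊆ R_k and h ∉ R_k for some k}, C_h = {k : h ∈ R_k \ T_k}, A_h = {(h,B) ∈ G} \ N (arcs with head h not in N), and F_k = {(h,B) ∈ G : B ⊆ R_k and (h,B) is a forward arc with respect to T_k}. Suppose E ⊆ G is a set of arcs such that for every vertex h with C_h ≠ ∅ and every k ∈ C_h, E ∩ A_h ∩ F_k ≠ ∅. Then for every loop L of G and every k with L ⊆ R_k \ T_k, there exists an arc (h,B) ∈ (J_G(L) \ N) ∩ E with B ⊆ R_k. -/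
open scoped Classical

variable {α : Type*}

/-- If a set `E` of arcs contains, for every vertex `h` with `C_h ≠ ∅` and every
`k ∈ C_h`, an arc of `A_h ∩ F_k`, then `E` justifies every loop: for every loop `L`
of `G` and every `k` with `L ⊆ R_k \ T_k`, some arc of `(J_G(L) \ N) ∩ E` has its
body contained in `R_k`. -/
theorem forward_arcs_justify_loops {α : Type*} (G : Set (Arc α))
    (hhead : ∀ e ∈ G, e.1 ∉ e.2)
    (n : ℕ) (T R : Fin n → Set α)
    (hTv : ∀ k, T k ⊆ verts G) (hRv : ∀ k, R k ⊆ verts G)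
    (hR : ∀ k, R k ⊆ reach G (T k))
    (E : Set (Arc α)) (hE : E ⊆ G)
    (hEjust : ∀ (h : α) (k : Fin n), h ∈ R k \ T k →
      (E ∩ (({e ∈ G | e.1 = h} \ {e ∈ G | ∃ k', (e.2 : Set α) ⊆ R k' ∧ e.1 ∉ R k'}) ∩
        {e ∈ G | (e.2 : Set α) ⊆ R k ∧ IsForward G (T k) e})).Nonempty) :
    ∀ L : Set α, IsLoop G L → ∀ k : Fin n, L ⊆ R k \ T k →
      ∃ e ∈ (Just G L \ {e ∈ G | ∃ k', (e.2 : Set α) ⊆ R k' ∧ e.1 ∉ R k'}) ∩ E,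
        (e.2 : Set α) ⊆ R k := by
  intro L hL k hLk
  obtain ⟨h, hh, hmin⟩ := WellFounded.has_min
    (InvImage.wf (hdist G (T k)) (wellFounded_lt (α := ℕ∞))) L hL.1
  obtain ⟨e, heE, ⟨⟨heG, rfl⟩, heN⟩, _, heR, hfwd⟩ := hEjust h k (hLk hh)
  exact ⟨e, ⟨⟨⟨heG, hh, fun b hb hbL => hmin b hbL (hfwd b hb)⟩, heN⟩, heE⟩, heR⟩
end
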